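/- arXiv:1303.6149 — 5 statements merged into one kernel-verified Lean document; each statement's English description precedes it below -/
import Mathlib

section
/- Under assumptions (A1) and (A3–A7), with constant step size γ > 0, for every n ≥ 1 the averaged stochastic gradient iterates satisfy E[f((1/n)·Σ_{k=1}^n θ_{k−1})] − f(θ*) + (1/(2γn))·E‖θ_n − θ*‖² ≤ (1/(2γn))·‖θ_0 − θ*‖² + (γ/2)·R². -/
open MeasureTheory

/-- First-order characterization of convexity: a convex function lies above its tangents. -/
lemma ConvexOn.sub_le_inner_gradient {H : Type*} [NormedAddCommGroup H] [InnerProductSpace ℝ H]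
    [CompleteSpace H] {f : H → ℝ} (hf : ConvexOn ℝ Set.univ f) {x : H}
    (hx : DifferentiableAt ℝ f x) (y : H) :
    f x - f y ≤ inner ℝ (x - y) (gradient f x) := by
  have hline : ConvexOn ℝ Set.univ (f ∘ AffineMap.lineMap (k := ℝ) x y) := by
    simpa using hf.comp_affineMap (AffineMap.lineMap x y)
  have hderiv : HasDerivAt (f ∘ AffineMap.lineMap (k := ℝ) x y) (fderiv ℝ f x (y - x)) 0 := by
    have h : HasFDerivAt f (fderiv ℝ f x) (AffineMap.lineMap x y (0 : ℝ)) := by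
      simpa using hx.hasFDerivAt
    exact h.comp_hasDerivAt 0 AffineMap.hasDerivAt_lineMap
  have hslope := hline.le_slope_of_hasDerivAt (Set.mem_univ 0) (Set.mem_univ 1) zero_lt_one hderiv
  have hgrad : inner ℝ (x - y) (gradient f x) = -fderiv ℝ f x (y - x) := by
    rw [real_inner_comm, inner_gradient_left, ← neg_sub y x, map_neg]
  simp only [slope_def_field, Function.comp_apply, AffineMap.lineMap_apply_one,
    AffineMap.lineMap_apply_zero, sub_zero, div_one] at hslope
  linarith

/-- Pull-out property of the conditional expectation for the inner product, integrated. -/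
lemma MeasureTheory.integral_inner_condExp_right {Ω H : Type*} [NormedAddCommGroup H]
    [InnerProductSpace ℝ H] [CompleteSpace H] {m mΩ : MeasurableSpace Ω} {μ : Measure Ω}
    [IsFiniteMeasure μ] (hm : m ≤ mΩ) {X Y : Ω → H} (hX : StronglyMeasurable[m] X)
    (hY : Integrable Y μ) {C : ℝ} (hC : ∀ᵐ ω ∂μ, ‖X ω‖ ≤ C) :
    ∫ ω, inner ℝ (X ω) (μ[Y|m] ω) ∂μ = ∫ ω, inner ℝ (X ω) (Y ω) ∂μ := by
  rw [← integral_condExp hm (f := fun ω => inner ℝ (X ω) (Y ω))]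
  exact integral_congr_ae
    (condExp_stronglyMeasurable_bilin_of_bound (innerSL ℝ) hm hX hY C hC).symm

/-- A convex function with bounded gradient and a minimizer is integrable along any almost surely
bounded random variable. -/
lemma ConvexOn.integrable_comp_of_gradient_bound {Ω H : Type*} [NormedAddCommGroup H]
    [InnerProductSpace ℝ H] [CompleteSpace H] {mΩ : MeasurableSpace Ω} {μ : Measure Ω}
    [IsFiniteMeasure μ] {f : H → ℝ} (hf : ConvexOn ℝ Set.univ f) (hd : Differentiable ℝ f)
    {x₀ : H} (hmin : ∀ x, f x₀ ≤ f x) {R : ℝ} (hR : ∀ x, ‖gradient f x‖ ≤ R)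
    {X : Ω → H} (hX : AEStronglyMeasurable X μ) {C : ℝ} (hC : ∀ᵐ ω ∂μ, ‖X ω - x₀‖ ≤ C) :
    Integrable (fun ω => f (X ω)) μ := by
  have hdiff : Integrable (fun ω => f (X ω) - f x₀) μ := by
    refine .of_bound ((hd.continuous.comp_aestronglyMeasurable hX).sub aestronglyMeasurable_const) (C * R) ?_
    filter_upwards [hC] with ω hω
    rw [Real.norm_of_nonneg (sub_nonneg.2 (hmin _))]
    calc f (X ω) - f x₀ ≤ inner ℝ (X ω - x₀) (gradient f (X ω)) :=
          hf.sub_le_inner_gradient (hd _) _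
      _ ≤ ‖X ω - x₀‖ * ‖gradient f (X ω)‖ := real_inner_le_norm _ _
      _ ≤ C * R := mul_le_mul hω (hR _) (norm_nonneg _) ((norm_nonneg _).trans hω)
  exact (hdiff.add (integrable_const (f x₀))).congr (by simp [Filter.EventuallyEq])

/-- Jensen's inequality for the uniform average of `n` points. -/
lemma ConvexOn.map_inv_smul_sum_range_le {H : Type*} [AddCommGroup H] [Module ℝ H] {f : H → ℝ}
    (hf : ConvexOn ℝ Set.univ f) {n : ℕ} (hn : n ≠ 0) (x : ℕ → H) :
    f ((n : ℝ)⁻¹ • ∑ k ∈ Finset.range n, x k) ≤ (n : ℝ)⁻¹ * ∑ k ∈ Finset.range n, f (x k) := by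
  have h := hf.map_sum_le (t := Finset.range n) (w := fun _ => (n : ℝ)⁻¹) (p := x)
    (fun _ _ => by positivity) (by simp [hn]) (fun _ _ => Set.mem_univ _)
  simpa only [← Finset.smul_sum, smul_eq_mul, ← Finset.mul_sum] using h


theorem bach_prop_old
    {H : Type*} [NormedAddCommGroup H] [InnerProductSpace ℝ H] [CompleteSpace H]
    {Ω : Type*} {mΩ : MeasurableSpace Ω} {P : Measure Ω} [IsProbabilityMeasure P]
    (ℱ : Filtration ℕ mΩ)
    (f : H → ℝ) (F : ℕ → Ω → H → ℝ) (θstar θ0 : H) (R γ : ℝ)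
    (θ : ℕ → Ω → H)
    (hR : 0 < R)
    (hγ : 0 < γ)
    -- (A1) convexity and differentiability of f
    (hf_conv : ConvexOn ℝ Set.univ f)
    (hf_diff : Differentiable ℝ f)
    -- (A3) attained global minimum
    (hmin : ∀ θ' : H, f θstar ≤ f θ')
    -- (A4) Lipschitz-continuity of f and the fₙ
    (hf_grad_bound : ∀ θ' : H, ‖gradient f θ'‖ ≤ R)
    (hF_grad_bound : ∀ n : ℕ, ∀ᵐ ω ∂P, ∀ θ' : H, ‖gradient (F n ω) θ'‖ ≤ R)
    (hF_conv : ∀ n ω, ConvexOn ℝ Set.univ (F n ω))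
    (hF_diff : ∀ n ω, Differentiable ℝ (F n ω))
    -- (A5) adapted measurability
    (hF_meas : ∀ n : ℕ, ∀ x : H, StronglyMeasurable[ℱ n] (fun ω => F n ω x))
    (hθ_adapted : ∀ n : ℕ, StronglyMeasurable[ℱ n] (θ n))
    -- (A6) unbiased gradients
    (hunbiased : ∀ n : ℕ, 1 ≤ n →
      P[(fun ω => gradient (F n ω) (θ (n - 1) ω))|ℱ (n - 1)]
        =ᵐ[P] fun ω => gradient f (θ (n - 1) ω))
    -- (A7) stochastic gradient recursion
    (hθ0 : ∀ ω, θ 0 ω = θ0)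
    (hrec : ∀ n : ℕ, 1 ≤ n → ∀ ω,
      θ n ω = θ (n - 1) ω - γ • gradient (F n ω) (θ (n - 1) ω))
    (n : ℕ) (hn : 1 ≤ n)
    :
    (∫ ω, f (((n : ℝ))⁻¹ • ∑ k ∈ Finset.range n, θ k ω) ∂P) - f θstar
      + 1 / (2 * γ * n) * ∫ ω, ‖θ n ω - θstar‖ ^ 2 ∂P
    ≤ 1 / (2 * γ * n) * ‖θ0 - θstar‖ ^ 2 + γ / 2 * R ^ 2 := by
  have hF := ae_all_iff.2 hF_grad_bound
  have hstep (k : ℕ) (ω : Ω) : θ (k + 1) ω = θ k ω - γ • gradient (F (k + 1) ω) (θ k ω) := by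
    simpa using hrec (k + 1) (by omega) ω
  have hθm (k : ℕ) : AEStronglyMeasurable (θ k) P :=
    ((hθ_adapted k).mono (ℱ.le k)).aestronglyMeasurable
  have hbound (k : ℕ) : ∀ᵐ ω ∂P, ‖θ k ω - θstar‖ ≤ ‖θ0 - θstar‖ + k * (γ * R) := by
    filter_upwards [hF] with ω hω
    induction k with
    | zero => simp [hθ0]
    | succ k ih =>
      have hg : ‖γ • gradient (F (k + 1) ω) (θ k ω)‖ ≤ γ * R := by
        rw [norm_smul, Real.norm_of_nonneg hγ.le]
        exact mul_le_mul_of_nonneg_left (hω _ _) hγ.le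
      rw [hstep, sub_right_comm]
      push_cast
      linarith [norm_sub_le (θ k ω - θstar) (γ • gradient (F (k + 1) ω) (θ k ω))]
  have hgm (k : ℕ) : AEStronglyMeasurable (fun ω => gradient (F (k + 1) ω) (θ k ω)) P := by
    have h : (fun ω => gradient (F (k + 1) ω) (θ k ω)) = γ⁻¹ • (θ k - θ (k + 1)) := by
      ext ω
      simp [hstep, smul_smul, hγ.ne']
    rw [h]
    exact ((hθm k).sub (hθm (k + 1))).const_smul _
  have hgi (k : ℕ) : Integrable (fun ω => gradient (F (k + 1) ω) (θ k ω)) P :=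
    .of_bound (hgm k) R (by filter_upwards [hF] with ω hω using hω _ _)
  have hDi (k : ℕ) : Integrable (fun ω => ‖θ k ω - θstar‖ ^ 2) P := by
    refine .of_bound (((hθm k).sub aestronglyMeasurable_const).norm.pow 2) ((‖θ0 - θstar‖ + k * (γ * R)) ^ 2) ?_
    filter_upwards [hbound k] with ω hω
    rw [norm_pow, norm_norm]
    gcongr
  have hfi (k : ℕ) : Integrable (fun ω => f (θ k ω)) P :=
    hf_conv.integrable_comp_of_gradient_bound hf_diff hmin hf_grad_bound (hθm k) (hbound k)
  have hii (k : ℕ) (Y : Ω → H) (hY : Integrable Y P) :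
      Integrable (fun ω => inner ℝ (θ k ω - θstar) (Y ω)) P :=
    (innerSL ℝ).integrable_of_bilin_of_bdd_left _ ((hθm k).sub aestronglyMeasurable_const) (hbound k) hY
  have hinner (k : ℕ) : (∫ ω, f (θ k ω) ∂P) - f θstar
      ≤ ∫ ω, inner ℝ (θ k ω - θstar) (gradient (F (k + 1) ω) (θ k ω)) ∂P := by
    have hcond : P[(fun ω => gradient (F (k + 1) ω) (θ k ω))|ℱ k]
        =ᵐ[P] fun ω => gradient f (θ k ω) := by
      simpa using hunbiased (k + 1) (by omega)
    rw [← integral_inner_condExp_right (X := fun ω => θ k ω - θstar) (ℱ.le k)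
      ((hθ_adapted k).sub stronglyMeasurable_const) (hgi k) (hbound k)]
    calc (∫ ω, f (θ k ω) ∂P) - f θstar = ∫ ω, (f (θ k ω) - f θstar) ∂P := by
          rw [integral_sub (hfi k) (integrable_const _)]
          simp
      _ ≤ _ := by
          refine integral_mono_ae ((hfi k).sub (integrable_const _))
            (hii k _ integrable_condExp) ?_
          filter_upwards [hcond] with ω hω
          rw [hω]
          exact hf_conv.sub_le_inner_gradient (hf_diff _) _
  have hdescent (k : ℕ) : ∫ ω, ‖θ (k + 1) ω - θstar‖ ^ 2 ∂P
      ≤ (∫ ω, ‖θ k ω - θstar‖ ^ 2 ∂P)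
        - 2 * γ * ((∫ ω, f (θ k ω) ∂P) - f θstar) + γ ^ 2 * R ^ 2 := by
    have hi := (hii k _ (hgi k)).const_mul (2 * γ)
    have hle : ∫ ω, ‖θ (k + 1) ω - θstar‖ ^ 2 ∂P
        ≤ ∫ ω, (‖θ k ω - θstar‖ ^ 2
          - 2 * γ * inner ℝ (θ k ω - θstar) (gradient (F (k + 1) ω) (θ k ω))
          + γ ^ 2 * R ^ 2) ∂P := by
      refine integral_mono_ae (hDi (k + 1)) (((hDi k).sub hi).add (integrable_const _)) ?_
      filter_upwards [hF] with ω hω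
      have hsq : ‖gradient (F (k + 1) ω) (θ k ω)‖ ^ 2 ≤ R ^ 2 := by
        gcongr
        exact hω _ _
      have := mul_le_mul_of_nonneg_left hsq (sq_nonneg γ)
      simp only [hstep]
      rw [sub_right_comm, norm_sub_sq_real, inner_smul_right, norm_smul, mul_pow,
        Real.norm_eq_abs, sq_abs]
      linarith
    rw [integral_add (by exact (hDi k).sub hi) (integrable_const _), integral_sub (hDi k) hi,
      integral_const_mul] at hle
    simp only [integral_const, probReal_univ, one_smul] at hle
    linarith [mul_le_mul_of_nonneg_left (hinner k) (by positivity : 0 ≤ 2 * γ)]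
  have htelescope (m : ℕ) : ∫ ω, ‖θ m ω - θstar‖ ^ 2 ∂P
      + 2 * γ * ((∑ k ∈ Finset.range m, ∫ ω, f (θ k ω) ∂P) - m * f θstar)
      ≤ ‖θ0 - θstar‖ ^ 2 + m * (γ ^ 2 * R ^ 2) := by
    induction m with
    | zero => simp [hθ0]
    | succ m ih =>
      rw [Finset.sum_range_succ]
      push_cast
      linarith [hdescent m]
  have hn0 : (0 : ℝ) < n := by exact_mod_cast hn
  have hjensen : ∫ ω, f ((n : ℝ)⁻¹ • ∑ k ∈ Finset.range n, θ k ω) ∂P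
      ≤ (n : ℝ)⁻¹ * ∑ k ∈ Finset.range n, ∫ ω, f (θ k ω) ∂P := by
    rw [← integral_finsetSum _ fun k _ => hfi k, ← integral_const_mul]
    refine integral_mono ?_ ((integrable_finsetSum _ fun k _ => hfi k).const_mul _)
      fun ω => hf_conv.map_inv_smul_sum_range_le (by omega) fun k => θ k ω
    refine hf_conv.integrable_comp_of_gradient_bound hf_diff hmin hf_grad_bound
      (C := (n : ℝ)⁻¹ * ∑ k ∈ Finset.range n, (‖θ0 - θstar‖ + k * (γ * R)))
      ((Finset.aestronglyMeasurable_fun_sum _ fun k _ => hθm k).const_smul _) ?_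
    filter_upwards [ae_all_iff.2 hbound] with ω hω
    have hcenter : (n : ℝ)⁻¹ • ∑ k ∈ Finset.range n, θ k ω - θstar
        = (n : ℝ)⁻¹ • ∑ k ∈ Finset.range n, (θ k ω - θstar) := by
      rw [Finset.sum_sub_distrib, smul_sub, Finset.sum_const, Finset.card_range,
        ← Nat.cast_smul_eq_nsmul ℝ, inv_smul_smul₀ hn0.ne']
    rw [hcenter, norm_smul, Real.norm_of_nonneg (by positivity)]
    gcongr
    exact norm_sum_le_of_le _ fun k _ => hω k
  have hscaled := mul_le_mul_of_nonneg_left (htelescope n)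
    (by positivity : 0 ≤ 1 / (2 * γ * n))
  have hexpand : 1 / (2 * γ * n) * ((∫ ω, ‖θ n ω - θstar‖ ^ 2 ∂P)
      + 2 * γ * ((∑ k ∈ Finset.range n, ∫ ω, f (θ k ω) ∂P) - n * f θstar))
      = 1 / (2 * γ * n) * (∫ ω, ‖θ n ω - θstar‖ ^ 2 ∂P)
        + ((n : ℝ)⁻¹ * ∑ k ∈ Finset.range n, ∫ ω, f (θ k ω) ∂P) - f θstar := by
    field_simp
    ring
  have hnoise : 1 / (2 * γ * n) * (‖θ0 - θstar‖ ^ 2 + n * (γ ^ 2 * R ^ 2))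
      = 1 / (2 * γ * n) * ‖θ0 - θstar‖ ^ 2 + γ / 2 * R ^ 2 := by
    field_simp
  linarith
end

section
/- Under assumptions (A1) and (A3–A7), with constant step size γ = 1/(2R²√N) for a fixed horizon N ≥ 1: (i) for every n ∈ {1,…,N}, E‖θ_n − θ*‖² ≤ ‖θ_0 − θ*‖² + 1/(4R²); and (ii) E[f((1/N)·Σ_{k=1}^N θ_{k−1})] − f(θ*) ≤ (R²/√N)·‖θ_0 − θ*‖² + 1/(4√N). -/
open MeasureTheory

theorem ConvexOn.add_inner_gradient_le {H : Type*} [NormedAddCommGroup H] [InnerProductSpace ℝ H]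
    [CompleteSpace H] {f : H → ℝ} (hf : ConvexOn ℝ Set.univ f) {x : H}
    (hd : DifferentiableAt ℝ f x) (y : H) :
    f x + inner ℝ (gradient f x) (y - x) ≤ f y := by
  have hconv : ConvexOn ℝ Set.univ (fun t : ℝ => f (AffineMap.lineMap x y t)) := by
    simpa using! hf.comp_affineMap (AffineMap.lineMap x y)
  have hderiv : HasDerivAt (fun t : ℝ => f (AffineMap.lineMap x y t))
      (inner ℝ (gradient f x) (y - x)) 0 := by
    have hx : HasFDerivAt f (InnerProductSpace.toDual ℝ H (gradient f x))
        (AffineMap.lineMap x y (0 : ℝ)) := by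
      rw [AffineMap.lineMap_apply_zero]
      exact hd.hasGradientAt.hasFDerivAt
    simpa using! hx.comp_hasDerivAt (0 : ℝ) AffineMap.hasDerivAt_lineMap
  have h := hconv.le_slope_of_hasDerivAt (Set.mem_univ 0) (Set.mem_univ 1) one_pos hderiv
  simp only [slope_def_field, AffineMap.lineMap_apply_one, AffineMap.lineMap_apply_zero, sub_zero,
    div_one] at h
  linarith

theorem integral_inner_condExp {H : Type*} [NormedAddCommGroup H] [InnerProductSpace ℝ H]
    [CompleteSpace H] {Ω : Type*} {m mΩ : MeasurableSpace Ω} {P : Measure Ω} [IsFiniteMeasure P]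
    (hm : m ≤ mΩ) {u g : Ω → H} (hu : StronglyMeasurable[m] u) (hg : Integrable g P)
    (hug : Integrable (fun ω => inner ℝ (u ω) (g ω)) P) :
    ∫ ω, inner ℝ (u ω) ((P[g|m]) ω) ∂P = ∫ ω, inner ℝ (u ω) (g ω) ∂P := by
  rw [← integral_condExp hm (f := fun ω => inner ℝ (u ω) (g ω))]
  exact integral_congr_ae
    (condExp_bilin_of_stronglyMeasurable_left (innerSL ℝ) hu hug hg).symm

/-- One step of the stochastic gradient method started at a bounded random point `x`. -/
theorem integral_norm_sub_smul_sub_sq_le {H : Type*} [NormedAddCommGroup H]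
    [InnerProductSpace ℝ H] [CompleteSpace H] {Ω : Type*} {m mΩ : MeasurableSpace Ω}
    {P : Measure Ω} [IsProbabilityMeasure P] (hm : m ≤ mΩ) {f : H → ℝ}
    (hf_conv : ConvexOn ℝ Set.univ f) (hf_diff : Differentiable ℝ f) {z : H} {x g : Ω → H}
    {C R γ : ℝ} (hγ : 0 ≤ γ) (hx : StronglyMeasurable[m] x) (hxC : ∀ᵐ ω ∂P, ‖x ω - z‖ ≤ C)
    (hg : AEStronglyMeasurable g P) (hgR : ∀ᵐ ω ∂P, ‖g ω‖ ≤ R)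
    (hcond : P[g|m] =ᵐ[P] fun ω => gradient f (x ω)) (hfx : Integrable (fun ω => f (x ω)) P) :
    ∫ ω, ‖x ω - γ • g ω - z‖ ^ 2 ∂P ≤
      ∫ ω, ‖x ω - z‖ ^ 2 ∂P - 2 * γ * (∫ ω, f (x ω) ∂P - f z) + γ ^ 2 * R ^ 2 := by
  have hu : StronglyMeasurable[m] (fun ω => x ω - z) := hx.sub stronglyMeasurable_const
  have hu' : AEStronglyMeasurable (fun ω => x ω - z) P := (hu.mono hm).aestronglyMeasurable
  have hg_int : Integrable g P := .of_bound hg R hgR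
  have hsq_int : Integrable (fun ω => ‖x ω - z‖ ^ 2) P := by
    refine .of_bound (hu'.norm.pow 2) (C ^ 2) ?_
    filter_upwards [hxC] with ω h
    rw [norm_pow, norm_norm]
    gcongr
  have hinner_int : Integrable (fun ω => inner ℝ (x ω - z) (g ω)) P := by
    refine .of_bound (hu'.inner hg) (C * R) ?_
    filter_upwards [hxC, hgR] with ω h₁ h₂
    exact (norm_inner_le_norm _ _).trans
      (mul_le_mul h₁ h₂ (norm_nonneg _) ((norm_nonneg _).trans h₁))
  have hcond_int : Integrable (fun ω => inner ℝ (x ω - z) ((P[g|m]) ω)) P :=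
    integrable_condExp.congr
      (condExp_bilin_of_stronglyMeasurable_left (innerSL ℝ) hu hinner_int hg_int)
  have hdescent : ∫ ω, f (x ω) ∂P - f z ≤ ∫ ω, inner ℝ (x ω - z) (g ω) ∂P := by
    rw [← integral_inner_condExp hm hu hg_int hinner_int]
    calc ∫ ω, f (x ω) ∂P - f z = ∫ ω, (f (x ω) - f z) ∂P := by
          rw [integral_sub hfx (integrable_const _)]; simp
      _ ≤ _ := by
          refine integral_mono_ae (hfx.sub (integrable_const _)) hcond_int ?_
          filter_upwards [hcond] with ω h
          have hsub := hf_conv.add_inner_gradient_le (hf_diff (x ω)) z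
          simp only [h]
          rw [real_inner_comm, ← neg_sub z, inner_neg_right]
          linarith
  calc ∫ ω, ‖x ω - γ • g ω - z‖ ^ 2 ∂P
      ≤ ∫ ω, (‖x ω - z‖ ^ 2 - 2 * γ * inner ℝ (x ω - z) (g ω) + γ ^ 2 * R ^ 2) ∂P := by
        refine integral_mono_of_nonneg (ae_of_all _ fun ω => by positivity)
          ((hsq_int.sub (hinner_int.const_mul _)).add (integrable_const _)) ?_
        filter_upwards [hgR] with ω h
        have hnorm : γ ^ 2 * ‖g ω‖ ^ 2 ≤ γ ^ 2 * R ^ 2 := by gcongr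
        rw [sub_right_comm, norm_sub_sq_real, inner_smul_right, norm_smul, mul_pow,
          Real.norm_eq_abs, sq_abs]
        linarith
    _ = ∫ ω, ‖x ω - z‖ ^ 2 ∂P - 2 * γ * ∫ ω, inner ℝ (x ω - z) (g ω) ∂P + γ ^ 2 * R ^ 2 := by
        have hsub_int : Integrable
            (fun ω => ‖x ω - z‖ ^ 2 - 2 * γ * inner ℝ (x ω - z) (g ω)) P :=
          hsq_int.sub (hinner_int.const_mul _)
        rw [integral_add hsub_int (integrable_const _), integral_sub hsq_int (hinner_int.const_mul _), integral_const_mul]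
        simp
    _ ≤ _ := by
        have := mul_le_mul_of_nonneg_left hdescent (by positivity : 0 ≤ 2 * γ)
        linarith

theorem bach_corollary_1
    {H : Type*} [NormedAddCommGroup H] [InnerProductSpace ℝ H] [CompleteSpace H]
    {Ω : Type*} {mΩ : MeasurableSpace Ω} {P : Measure Ω} [IsProbabilityMeasure P]
    (ℱ : Filtration ℕ mΩ)
    (f : H → ℝ) (F : ℕ → Ω → H → ℝ) (θstar θ0 : H) (R γ : ℝ)
    (θ : ℕ → Ω → H)
    (hR : 0 < R)
    (N : ℕ) (hN : 1 ≤ N)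
    (hγ : γ = 1 / (2 * R ^ 2 * Real.sqrt N))
    -- (A1) convexity and differentiability of f
    (hf_conv : ConvexOn ℝ Set.univ f)
    (hf_diff : Differentiable ℝ f)
    -- (A3) attained global minimum
    (hmin : ∀ θ' : H, f θstar ≤ f θ')
    -- (A4) Lipschitz-continuity of f and the fₙ
    (hf_grad_bound : ∀ θ' : H, ‖gradient f θ'‖ ≤ R)
    (hF_grad_bound : ∀ n : ℕ, ∀ᵐ ω ∂P, ∀ θ' : H, ‖gradient (F n ω) θ'‖ ≤ R)
    (hF_conv : ∀ n ω, ConvexOn ℝ Set.univ (F n ω))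
    (hF_diff : ∀ n ω, Differentiable ℝ (F n ω))
    -- (A5) adapted measurability
    (hF_meas : ∀ n : ℕ, ∀ x : H, StronglyMeasurable[ℱ n] (fun ω => F n ω x))
    (hθ_adapted : ∀ n : ℕ, StronglyMeasurable[ℱ n] (θ n))
    -- (A6) unbiased gradients
    (hunbiased : ∀ n : ℕ, 1 ≤ n →
      P[(fun ω => gradient (F n ω) (θ (n - 1) ω))|ℱ (n - 1)]
        =ᵐ[P] fun ω => gradient f (θ (n - 1) ω))
    -- (A7) stochastic gradient recursion
    (hθ0 : ∀ ω, θ 0 ω = θ0)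
    (hrec : ∀ n : ℕ, 1 ≤ n → ∀ ω,
      θ n ω = θ (n - 1) ω - γ • gradient (F n ω) (θ (n - 1) ω))
    :
    (∀ n : ℕ, 1 ≤ n → n ≤ N →
      ∫ ω, ‖θ n ω - θstar‖ ^ 2 ∂P ≤ ‖θ0 - θstar‖ ^ 2 + 1 / (4 * R ^ 2)) ∧
    ((∫ ω, f (((N : ℝ))⁻¹ • ∑ k ∈ Finset.range N, θ k ω) ∂P) - f θstar
      ≤ R ^ 2 / Real.sqrt N * ‖θ0 - θstar‖ ^ 2 + 1 / (4 * Real.sqrt N)) := by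
  have hN0 : (0 : ℝ) < N := by exact_mod_cast hN
  have hs : 0 < Real.sqrt N := Real.sqrt_pos.mpr hN0
  have hss : Real.sqrt N ^ 2 = N := Real.sq_sqrt hN0.le
  have hγ0 : 0 < γ := by rw [hγ]; positivity
  have hstep : ∀ n ω, θ (n + 1) ω = θ n ω - γ • gradient (F (n + 1) ω) (θ n ω) := fun n ω => by
    simpa using hrec (n + 1) (by omega) ω
  have hθ_meas : ∀ n, StronglyMeasurable (θ n) := fun n => (hθ_adapted n).mono (ℱ.le n)
  have hg_meas : ∀ n, AEStronglyMeasurable (fun ω => gradient (F (n + 1) ω) (θ n ω)) P := by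
    intro n
    have h : (fun ω => gradient (F (n + 1) ω) (θ n ω)) =
        fun ω => γ⁻¹ • (θ n ω - θ (n + 1) ω) := by
      funext ω
      rw [hstep n ω, sub_sub_cancel, inv_smul_smul₀ hγ0.ne']
    rw [h]
    exact (((hθ_meas n).sub (hθ_meas (n + 1))).const_smul γ⁻¹).aestronglyMeasurable
  have hθ_bound : ∀ n, ∃ C, ∀ᵐ ω ∂P, ‖θ n ω - θstar‖ ≤ C := by
    intro n
    induction n with
    | zero => exact ⟨‖θ0 - θstar‖, ae_of_all _ fun ω => by rw [hθ0]⟩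
    | succ n ih =>
      obtain ⟨C, hC⟩ := ih
      refine ⟨C + γ * R, ?_⟩
      filter_upwards [hC, hF_grad_bound (n + 1)] with ω h₁ h₂
      rw [hstep, sub_right_comm]
      refine (norm_sub_le _ _).trans (add_le_add h₁ ?_)
      rw [norm_smul, Real.norm_of_nonneg hγ0.le]
      exact mul_le_mul_of_nonneg_left (h₂ _) hγ0.le
  have hf_int : ∀ n, Integrable (fun ω => f (θ n ω)) P := by
    intro n
    obtain ⟨C, hC⟩ := hθ_bound n
    have hgap : Integrable (fun ω => f (θ n ω) - f θstar) P := by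
      refine .of_bound ((hf_diff.continuous.comp_stronglyMeasurable (hθ_meas n)).sub
        stronglyMeasurable_const).aestronglyMeasurable (R * C) ?_
      filter_upwards [hC] with ω h
      rw [Real.norm_of_nonneg (sub_nonneg.mpr (hmin _))]
      have hsub := hf_conv.add_inner_gradient_le (hf_diff (θ n ω)) θstar
      rw [← neg_sub (θ n ω), inner_neg_right] at hsub
      have hcs := real_inner_le_norm (gradient f (θ n ω)) (θ n ω - θstar)
      have := mul_le_mul (hf_grad_bound (θ n ω)) h (norm_nonneg _) hR.le
      linarith
    exact (hgap.add (integrable_const (f θstar))).congr (ae_of_all _ fun ω => sub_add_cancel _ _)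
  have hsum : ∀ n : ℕ, ∫ ω, ‖θ n ω - θstar‖ ^ 2 ∂P
      + 2 * γ * ∑ k ∈ Finset.range n, (∫ ω, f (θ k ω) ∂P - f θstar)
      ≤ ‖θ0 - θstar‖ ^ 2 + n * (γ ^ 2 * R ^ 2) := by
    intro n
    induction n with
    | zero => simp [hθ0]
    | succ n ih =>
      obtain ⟨C, hC⟩ := hθ_bound n
      have h := integral_norm_sub_smul_sub_sq_le (ℱ.le n) hf_conv hf_diff hγ0.le
        (hθ_adapted n) hC (hg_meas n) ((hF_grad_bound (n + 1)).mono fun ω h => h _)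
        (by simpa using hunbiased (n + 1) (by omega)) (hf_int n)
      simp only [← hstep] at h
      rw [Finset.sum_range_succ]
      push_cast
      linarith
  have hgap_nonneg : ∀ n, 0 ≤ ∫ ω, f (θ n ω) ∂P - f θstar := by
    intro n
    have h := integral_mono (integrable_const (f θstar)) (hf_int n) fun ω => hmin (θ n ω)
    simp only [integral_const, probReal_univ, one_smul] at h
    linarith
  have hvar : N * (γ ^ 2 * R ^ 2) = 1 / (4 * R ^ 2) := by
    rw [hγ, div_pow, mul_pow, hss]
    field_simp
    ring
  refine ⟨fun n _ hnN => ?_, ?_⟩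
  · have h₁ : 0 ≤ 2 * γ * ∑ k ∈ Finset.range n, (∫ ω, f (θ k ω) ∂P - f θstar) :=
      mul_nonneg (by positivity) (Finset.sum_nonneg fun k _ => hgap_nonneg k)
    have h₂ : n * (γ ^ 2 * R ^ 2) ≤ N * (γ ^ 2 * R ^ 2) := by gcongr
    linarith [hsum n]
  · have hjensen : ∫ ω, f ((N : ℝ)⁻¹ • ∑ k ∈ Finset.range N, θ k ω) ∂P - f θstar
        ≤ (N : ℝ)⁻¹ * ∑ k ∈ Finset.range N, (∫ ω, f (θ k ω) ∂P - f θstar) := by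
      have hpt : ∀ ω, f ((N : ℝ)⁻¹ • ∑ k ∈ Finset.range N, θ k ω) - f θstar
          ≤ (N : ℝ)⁻¹ * ∑ k ∈ Finset.range N, (f (θ k ω) - f θstar) := by
        intro ω
        have h := hf_conv.map_sum_le (t := Finset.range N) (w := fun _ => (N : ℝ)⁻¹)
          (p := fun k => θ k ω) (fun _ _ => by positivity) (by simp [hN0.ne']) (by simp)
        rw [← Finset.smul_sum, ← Finset.smul_sum, smul_eq_mul] at h
        rw [Finset.sum_sub_distrib, Finset.sum_const, Finset.card_range, nsmul_eq_mul, mul_sub,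
          inv_mul_cancel_left₀ hN0.ne']
        linarith
      have hgap_int : ∀ k, Integrable (fun ω => f (θ k ω) - f θstar) P :=
        fun k => (hf_int k).sub (integrable_const _)
      have hrhs_int : Integrable
          (fun ω => (N : ℝ)⁻¹ * ∑ k ∈ Finset.range N, (f (θ k ω) - f θstar)) P :=
        (integrable_finsetSum _ fun k _ => hgap_int k).const_mul _
      have havg_meas : StronglyMeasurable
          (fun ω => f ((N : ℝ)⁻¹ • ∑ k ∈ Finset.range N, θ k ω)) :=
        hf_diff.continuous.comp_stronglyMeasurable
          ((Finset.stronglyMeasurable_fun_sum _ fun k _ => hθ_meas k).const_smul _)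
      have havg_int : Integrable
          (fun ω => f ((N : ℝ)⁻¹ • ∑ k ∈ Finset.range N, θ k ω) - f θstar) P := by
        refine hrhs_int.mono' (havg_meas.sub stronglyMeasurable_const).aestronglyMeasurable
          (ae_of_all _ fun ω => ?_)
        rw [Real.norm_of_nonneg (sub_nonneg.mpr (hmin _))]
        exact hpt ω
      have h := integral_mono havg_int hrhs_int hpt
      rw [integral_sub ((havg_int.add (integrable_const (f θstar))).congr
        (ae_of_all _ fun ω => sub_add_cancel _ _)) (integrable_const _), integral_const_mul,
        integral_finsetSum _ fun k _ => hgap_int k] at h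
      simp only [integral_sub (hf_int _) (integrable_const _), integral_const, probReal_univ,
        one_smul] at h
      exact h
    have hdist : 0 ≤ ∫ ω, ‖θ N ω - θstar‖ ^ 2 ∂P := integral_nonneg fun ω => by positivity
    have hscale : (N : ℝ)⁻¹ = R ^ 2 / Real.sqrt N * (2 * γ) := by
      rw [hγ, ← hss, Real.sqrt_sq hs.le]
      field_simp
    calc _ ≤ _ := hjensen
      _ = R ^ 2 / Real.sqrt N *
          (2 * γ * ∑ k ∈ Finset.range N, (∫ ω, f (θ k ω) ∂P - f θstar)) := by
          rw [hscale]; ring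
      _ ≤ R ^ 2 / Real.sqrt N * (‖θ0 - θstar‖ ^ 2 + 1 / (4 * R ^ 2)) := by
          gcongr
          linarith [hsum N]
      _ = _ := by field_simp
end

section
/- Under assumptions (A1) and (A3–A7), with constant step size γ > 0, for every n ≥ 1 and every integer p ≥ 1, letting θ̄_n = (1/n)·Σ_{k=0}^{n−1} θ_k, one has E[(2γn·(f(θ̄_n) − f(θ*)) + ‖θ_n − θ*‖²)^p] ≤ (3‖θ_0 − θ*‖² + 20·n·p·γ²R²)^p. -/
open MeasureTheory

/-- `y ↦ g y` lies below an affine function of `y ^ N` with nonnegative slope that agrees with `g`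
at `V`. -/
def HasPowMajorant (N : ℕ) (V : ℝ) (g : ℝ → ℝ) : Prop :=
  ∃ l : ℝ, 0 ≤ l ∧ ∀ y, 0 ≤ y → g y ≤ g V + l * (y ^ N - V ^ N)

namespace HasPowMajorant

variable {N : ℕ} {V : ℝ}

lemma pow (hV : 0 < V) {j : ℕ} (hN : 0 < N) (hj : j ≤ N) :
    HasPowMajorant N V (fun y => y ^ j) := by
  have hN' : (0 : ℝ) < N := by exact_mod_cast hN
  have hj' : (j : ℝ) ≤ N := by exact_mod_cast hj
  refine ⟨V ^ j / V ^ N * (j / N), by positivity, fun y hy => ?_⟩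
  have key : (y / V) ^ j ≤ (j / N : ℝ) * (y / V) ^ N + (1 - j / N) * 1 := by
    have h := Real.geom_mean_le_arith_mean2_weighted (w₁ := (j / N : ℝ)) (w₂ := 1 - j / N)
      (p₁ := (y / V) ^ N) (p₂ := 1) (by positivity)
      (sub_nonneg.2 ((div_le_one hN').2 hj')) (by positivity) zero_le_one (by ring)
    rw [Real.one_rpow, mul_one, ← Real.rpow_natCast, ← Real.rpow_mul (by positivity),
      mul_div_cancel₀ _ hN'.ne', Real.rpow_natCast] at h
    simpa using h
  have h2 := mul_le_mul_of_nonneg_left key (pow_nonneg hV.le j)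
  have e1 : V ^ j * (y / V) ^ j = y ^ j := by
    rw [← mul_pow, mul_div_cancel₀ _ hV.ne']
  rw [e1] at h2
  refine h2.trans (le_of_eq ?_)
  rw [div_pow]
  field_simp
  ring

lemma const_mul {g : ℝ → ℝ} {a : ℝ} (ha : 0 ≤ a) (hg : HasPowMajorant N V g) :
    HasPowMajorant N V (fun y => a * g y) := by
  obtain ⟨l, hl, h⟩ := hg
  refine ⟨a * l, by positivity, fun y hy => ?_⟩
  have := mul_le_mul_of_nonneg_left (h y hy) ha
  linarith

lemma sum {ι : Type*} {s : Finset ι} {g : ι → ℝ → ℝ} (hg : ∀ i ∈ s, HasPowMajorant N V (g i)) :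
    HasPowMajorant N V (fun y => ∑ i ∈ s, g i y) := by
  choose! l hl h using hg
  refine ⟨∑ i ∈ s, l i, Finset.sum_nonneg hl, fun y hy => ?_⟩
  rw [Finset.sum_mul, ← Finset.sum_add_distrib]
  exact Finset.sum_le_sum fun i hi => h i hi y hy

lemma sq_add_pow_mul_pow (hV : 0 < V) {c : ℝ} (hc : 0 ≤ c) {p k : ℕ} (hp : 0 < p) (hk : k ≤ p) :
    HasPowMajorant (2 * p) V (fun y => (y ^ 2 + c) ^ (p - k) * y ^ k) := by
  have e : (fun y : ℝ => (y ^ 2 + c) ^ (p - k) * y ^ k) = fun y =>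
      ∑ j ∈ Finset.range (p - k + 1), (c ^ (p - k - j) * ((p - k).choose j)) * y ^ (2 * j + k) := by
    funext y
    rw [add_pow, Finset.sum_mul]
    refine Finset.sum_congr rfl fun j _ => ?_
    rw [← pow_mul, pow_add]
    ring
  rw [e]
  refine sum fun j hj => const_mul (by positivity) (pow hV (by omega) ?_)
  have := Finset.mem_range.1 hj
  omega

end HasPowMajorant

lemma add_pow_sub_linear (b m : ℝ) {p : ℕ} (hp : 1 ≤ p) :
    (b + m) ^ p - p * b ^ (p - 1) * m =
      ∑ k ∈ (Finset.range (p + 1)).erase 1, (p.choose k : ℝ) * (b ^ (p - k) * m ^ k) := by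
  rw [add_comm b m, add_pow, ← Finset.add_sum_erase _ _ (Finset.mem_range.2 (by omega : 1 < p + 1))]
  simp only [pow_one, Nat.choose_one_right]
  rw [add_sub_right_comm, sub_eq_zero.2 (by ring), zero_add]
  exact Finset.sum_congr rfl fun k _ => by ring

lemma add_pow_sub_linear_mono {b m t : ℝ} (hb : 0 ≤ b) (hm : |m| ≤ t) {p : ℕ} (hp : 1 ≤ p) :
    (b + m) ^ p - p * b ^ (p - 1) * m ≤ (b + t) ^ p - p * b ^ (p - 1) * t := by
  rw [add_pow_sub_linear b m hp, add_pow_sub_linear b t hp]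
  refine Finset.sum_le_sum fun k _ => ?_
  have : m ^ k ≤ t ^ k := (le_abs_self _).trans (by
    rw [abs_pow]; exact pow_le_pow_left₀ (abs_nonneg m) hm k)
  gcongr

lemma hasPowMajorant_add_pow_sub_linear {V c s : ℝ} (hV : 0 < V) (hc : 0 ≤ c) (hs : 0 ≤ s) {p : ℕ}
    (hp : 1 ≤ p) : HasPowMajorant (2 * p) V
      (fun y => (y ^ 2 + c + s * y) ^ p - p * (y ^ 2 + c) ^ (p - 1) * (s * y)) := by
  have e : (fun y : ℝ => (y ^ 2 + c + s * y) ^ p - p * (y ^ 2 + c) ^ (p - 1) * (s * y)) = fun y =>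
      ∑ k ∈ (Finset.range (p + 1)).erase 1,
        ((p.choose k : ℝ) * s ^ k) * ((y ^ 2 + c) ^ (p - k) * y ^ k) := by
    funext y
    rw [add_pow_sub_linear _ _ hp]
    exact Finset.sum_congr rfl fun k _ => by rw [mul_pow]; ring
  rw [e]
  refine .sum fun k hk => .const_mul (by positivity) (.sq_add_pow_mul_pow hV hc hp ?_)
  have := Finset.mem_range.1 (Finset.mem_of_mem_erase hk)
  omega

lemma add_pow_sub_linear_le {b t : ℝ} (hb : 0 < b) (ht : 0 ≤ t) {p : ℕ} (hp : 1 ≤ p)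
    (hpt : p * t ≤ b) :
    (b + t) ^ p - p * b ^ (p - 1) * t ≤ b ^ p * (1 + (p * (t / b)) ^ 2) := by
  have h1 : (1 + t / b) ^ p ≤ 1 + p * (t / b) + (p * (t / b)) ^ 2 := by
    have h0 : 0 ≤ p * (t / b) := by positivity
    have hle : p * (t / b) ≤ 1 := by rw [← mul_div_assoc]; exact (div_le_one hb).2 hpt
    have h2 := (abs_le.1 (Real.abs_exp_sub_one_sub_id_le (x := p * (t / b))
      (by rwa [abs_of_nonneg h0]))).2
    have h3 : (1 + t / b) ^ p ≤ Real.exp (p * (t / b)) := by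
      rw [Real.exp_nat_mul]
      exact pow_le_pow_left₀ (by positivity) (by linarith [Real.add_one_le_exp (t / b)]) _
    linarith
  have e1 : (b + t) ^ p = b ^ p * (1 + t / b) ^ p := by
    rw [← mul_pow]; congr 1; field_simp
  have e2 : p * b ^ (p - 1) * t = b ^ p * (p * (t / b)) := by
    obtain ⟨q, rfl⟩ : ∃ q, p = q + 1 := ⟨p - 1, by omega⟩
    simp only [Nat.add_sub_cancel, pow_succ]
    field_simp
  rw [e1, e2, ← mul_sub]
  exact mul_le_mul_of_nonneg_left (by linarith) (by positivity)

/-- The numerical inequality closing the moment induction, once `U` dominates `p ^ 2 * c`. -/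
lemma add_pow_sub_linear_le_pow {V r : ℝ} (hV : 0 < V) (hr : 0 ≤ r) {p : ℕ} (hp : 1 ≤ p)
    (h : 10 * p * r ≤ V) :
    (V ^ 2 + r ^ 2 + 4 * r * V) ^ p - p * (V ^ 2 + r ^ 2) ^ (p - 1) * (4 * r * V) ≤
      (V ^ 2 + 20 * p * r ^ 2) ^ p := by
  have hp' : (1 : ℝ) ≤ p := by exact_mod_cast hp
  have hpr : 0 ≤ p * r := by positivity
  have hb : 0 < V ^ 2 + r ^ 2 := by positivity
  refine (add_pow_sub_linear_le hb (by positivity) hp (by nlinarith)).trans ?_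
  have h1 : (p * (4 * r * V / (V ^ 2 + r ^ 2))) ^ 2 ≤ p * (16 * p * (r ^ 2 / V ^ 2)) := by
    have : 4 * r * V / (V ^ 2 + r ^ 2) ≤ 4 * r * V / V ^ 2 := by
      gcongr; nlinarith
    calc _ ≤ (p * (4 * r * V / V ^ 2)) ^ 2 := by gcongr
      _ = _ := by field_simp; ring
  have h2 : 1 + p * (16 * p * (r ^ 2 / V ^ 2)) ≤ (1 + 16 * p * (r ^ 2 / V ^ 2)) ^ p :=
    one_add_mul_le_pow (le_trans (by norm_num) (by positivity : (0:ℝ) ≤ 16 * p * (r ^ 2 / V ^ 2))) p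
  calc (V ^ 2 + r ^ 2) ^ p * (1 + (p * (4 * r * V / (V ^ 2 + r ^ 2))) ^ 2)
      ≤ (V ^ 2 + r ^ 2) ^ p * (1 + 16 * p * (r ^ 2 / V ^ 2)) ^ p := by
        gcongr; linarith
    _ = ((V ^ 2 + r ^ 2) * (1 + 16 * p * (r ^ 2 / V ^ 2))) ^ p := (mul_pow _ _ _).symm
    _ ≤ _ := by
        gcongr
        have h3 : (p * r ^ 2) * (r ^ 2 / V ^ 2) ≤ r ^ 2 / 100 := by
          rw [← mul_div_assoc, div_le_iff₀ (by positivity)]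
          have h5 : p * r ^ 2 ≤ V ^ 2 / 100 := by nlinarith
          nlinarith [sq_nonneg r]
        have h4 : V ^ 2 * (r ^ 2 / V ^ 2) = r ^ 2 := by field_simp
        nlinarith [sq_nonneg r]

/-- One step of the moment recursion. -/
lemma integral_pow_le_of_step {Ω : Type*} {mΩ : MeasurableSpace Ω} {P : Measure Ω}
    [IsProbabilityMeasure P] {A A' M : Ω → ℝ} {V r : ℝ} {p : ℕ} (hp : 1 ≤ p) (hV : 0 < V)
    (hr : 0 ≤ r) (hVr : 10 * p * r ≤ V)
    (hA : ∀ ω, 0 ≤ A ω) (hA' : ∀ ω, 0 ≤ A' ω)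
    (hstep : ∀ᵐ ω ∂P, A' ω ≤ A ω + r ^ 2 + M ω)
    (hM : ∀ᵐ ω ∂P, |M ω| ≤ 4 * r * √(A ω))
    (hAint : Integrable (fun ω => A ω ^ p) P)
    (hMint : Integrable (fun ω => (A ω + r ^ 2) ^ (p - 1) * M ω) P)
    (hMzero : ∫ ω, (A ω + r ^ 2) ^ (p - 1) * M ω ∂P = 0)
    (hAle : ∫ ω, A ω ^ p ∂P ≤ (V ^ 2) ^ p) :
    ∫ ω, A' ω ^ p ∂P ≤ (V ^ 2 + 20 * p * r ^ 2) ^ p := by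
  obtain ⟨l, hl, h⟩ := hasPowMajorant_add_pow_sub_linear hV (sq_nonneg r)
    (by positivity : 0 ≤ 4 * r) hp
  set G := (V ^ 2 + r ^ 2 + 4 * r * V) ^ p - p * (V ^ 2 + r ^ 2) ^ (p - 1) * (4 * r * V)
  have hGint : Integrable (fun ω => p * ((A ω + r ^ 2) ^ (p - 1) * M ω)
      + (l * A ω ^ p + (G - l * (V ^ 2) ^ p))) P :=
    (hMint.const_mul _).add ((hAint.const_mul _).add (integrable_const _))
  calc ∫ ω, A' ω ^ p ∂P
      ≤ ∫ ω, p * ((A ω + r ^ 2) ^ (p - 1) * M ω) + (l * A ω ^ p + (G - l * (V ^ 2) ^ p)) ∂P := by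
        refine integral_mono_of_nonneg (.of_forall fun ω => pow_nonneg (hA' ω) p) hGint ?_
        filter_upwards [hstep, hM] with ω h1 h2
        have h3 := h (√(A ω)) (Real.sqrt_nonneg _)
        simp only [pow_mul, Real.sq_sqrt (hA ω)] at h3
        have h4 := add_pow_sub_linear_mono (add_nonneg (hA ω) (sq_nonneg r)) h2 hp
        have h5 := pow_le_pow_left₀ (hA' ω) h1 p
        linarith
    _ = l * ∫ ω, A ω ^ p ∂P + (G - l * (V ^ 2) ^ p) := by
        have hAGint : Integrable (fun ω => l * A ω ^ p + (G - l * (V ^ 2) ^ p)) P :=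
          (hAint.const_mul _).add (integrable_const _)
        rw [integral_add (hMint.const_mul _) hAGint,
          integral_add (hAint.const_mul _) (integrable_const _), integral_const_mul,
          integral_const_mul, hMzero]
        simp
    _ ≤ G := by nlinarith
    _ ≤ _ := add_pow_sub_linear_le_pow hV hr hp hVr

lemma ConvexOn.inner_gradient_sub_le {H : Type*} [NormedAddCommGroup H] [InnerProductSpace ℝ H]
    [CompleteSpace H] {f : H → ℝ} (hf : ConvexOn ℝ Set.univ f) {x : H}
    (hd : DifferentiableAt ℝ f x) (y : H) :
    f x - f y ≤ inner ℝ (gradient f x) (x - y) := by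
  have hc := hf.comp_affineMap (AffineMap.lineMap x y : ℝ →ᵃ[ℝ] H)
  have hder : HasDerivAt (f ∘ (AffineMap.lineMap x y : ℝ → H)) (fderiv ℝ f x (y - x)) 0 := by
    refine HasFDerivAt.comp_hasDerivAt (x := (0 : ℝ)) (f := (AffineMap.lineMap x y : ℝ → H)) (l := f)
      ?_ AffineMap.hasDerivAt_lineMap
    simpa using hd.hasFDerivAt
  have := hc.le_slope_of_hasDerivAt (Set.mem_univ 0) (Set.mem_univ 1) zero_lt_one hder
  simp only [Function.comp_apply, slope_def_field, AffineMap.lineMap_apply_zero,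
    AffineMap.lineMap_apply_one, sub_zero, div_one] at this
  rw [inner_gradient_left, ← neg_sub y x, map_neg]
  linarith

section Recursion

variable {H : Type*} [NormedAddCommGroup H]

/-- The sum of `2 * γ` times the accumulated excess values and the squared distance of the `n`-th
iterate to the reference point. -/
noncomputable def energy (f : H → ℝ) (z : H) (γ : ℝ) (x : ℕ → H) (n : ℕ) : ℝ :=
  2 * γ * ∑ k ∈ Finset.range n, (f (x k) - f z) + ‖x n - z‖ ^ 2

variable {f : H → ℝ} {z : H} {γ R : ℝ} {x : ℕ → H}

lemma sq_norm_le_energy (hγ : 0 ≤ γ) (hmin : ∀ y, f z ≤ f y) (n : ℕ) :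
    ‖x n - z‖ ^ 2 ≤ energy f z γ x n := by
  have := Finset.sum_nonneg (s := Finset.range n) fun k _ => sub_nonneg.2 (hmin (x k))
  exact le_add_of_nonneg_left (by positivity)

lemma energy_nonneg (hγ : 0 ≤ γ) (hmin : ∀ y, f z ≤ f y) (n : ℕ) : 0 ≤ energy f z γ x n :=
  (sq_nonneg _).trans (sq_norm_le_energy hγ hmin n)

lemma norm_sub_le_of_steps {r : ℝ} (hx : ∀ k, ‖x (k + 1) - x k‖ ≤ r) (n : ℕ) :
    ‖x n - z‖ ≤ ‖x 0 - z‖ + n * r := by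
  induction n with
  | zero => simp
  | succ n ih =>
    have := norm_add_le (x (n + 1) - x n) (x n - z)
    rw [sub_add_sub_cancel] at this
    push_cast
    linarith [hx n]

lemma energy_le (hγ : 0 ≤ γ) (hR : 0 ≤ R) (hf : ∀ y, f y - f z ≤ R * ‖y - z‖)
    (hx : ∀ k, ‖x (k + 1) - x k‖ ≤ γ * R) (n : ℕ) :
    energy f z γ x n ≤ 3 * ‖x 0 - z‖ ^ 2 + 4 * n ^ 2 * (γ * R) ^ 2 := by
  have hsum : 2 * γ * ∑ k ∈ Finset.range n, (f (x k) - f z) ≤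
      2 * (γ * R) * n * ‖x 0 - z‖ + n ^ 2 * (γ * R) ^ 2 := by
    induction n with
    | zero => simp
    | succ n ih =>
      rw [Finset.sum_range_succ, mul_add]
      have h1 : γ * (f (x n) - f z) ≤ γ * R * (‖x 0 - z‖ + n * (γ * R)) := by
        rw [mul_assoc γ R]
        exact mul_le_mul_of_nonneg_left ((hf _).trans
          (mul_le_mul_of_nonneg_left (norm_sub_le_of_steps hx n) hR)) hγ
      push_cast
      nlinarith [sq_nonneg (γ * R)]
  have h2 := pow_le_pow_left₀ (norm_nonneg _) (norm_sub_le_of_steps (z := z) hx n) 2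
  unfold energy
  nlinarith [sq_nonneg (‖x 0 - z‖ - n * (γ * R))]

variable [InnerProductSpace ℝ H]

lemma average_le_energy (hγ : 0 ≤ γ) (hf : ConvexOn ℝ Set.univ f) {n : ℕ} (hn : 1 ≤ n) :
    2 * γ * n * (f ((n : ℝ)⁻¹ • ∑ k ∈ Finset.range n, x k) - f z) + ‖x n - z‖ ^ 2 ≤
      energy f z γ x n := by
  have hn' : (0 : ℝ) < n := by exact_mod_cast hn
  have h := hf.map_sum_le (t := Finset.range n) (w := fun _ => (n : ℝ)⁻¹) (p := x)
    (fun _ _ => by positivity) (by simp [hn'.ne']) (fun _ _ => Set.mem_univ _)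
  rw [← Finset.smul_sum, ← Finset.smul_sum, smul_eq_mul] at h
  have h2 : n * (f ((n : ℝ)⁻¹ • ∑ k ∈ Finset.range n, x k) - f z) ≤
      ∑ k ∈ Finset.range n, (f (x k) - f z) := by
    rw [Finset.sum_sub_distrib, Finset.sum_const, Finset.card_range, nsmul_eq_mul, mul_sub]
    have := mul_le_mul_of_nonneg_left h hn'.le
    rw [mul_inv_cancel_left₀ hn'.ne'] at this
    linarith
  have := mul_le_mul_of_nonneg_left h2 (by positivity : 0 ≤ 2 * γ)
  unfold energy
  linarith

lemma energy_succ_le {g : H} {a : ℝ} (hγ : 0 ≤ γ) {n : ℕ} (hx : x (n + 1) = x n - γ • g)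
    (hg : ‖g‖ ≤ R) {v : H} (hv : f (x n) - f z ≤ inner ℝ v (x n - z))
    (ha : a = -2 * γ * inner ℝ (x n - z) (g - v)) :
    energy f z γ x (n + 1) ≤ energy f z γ x n + (γ * R) ^ 2 + a := by
  have h1 : ‖x (n + 1) - z‖ ^ 2 =
      ‖x n - z‖ ^ 2 - 2 * γ * inner ℝ (x n - z) g + γ ^ 2 * ‖g‖ ^ 2 := by
    rw [hx, sub_right_comm, norm_sub_sq_real, inner_smul_right, norm_smul, mul_pow,
      Real.norm_eq_abs, sq_abs]
    ring
  have h2 : γ ^ 2 * ‖g‖ ^ 2 ≤ (γ * R) ^ 2 := by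
    rw [mul_pow]; gcongr
  have h3 := mul_le_mul_of_nonneg_left hv hγ
  rw [real_inner_comm] at h3
  rw [ha, inner_sub_right]
  unfold energy
  rw [Finset.sum_range_succ, h1]
  linarith

end Recursion

section CondExp

variable {H : Type*} [NormedAddCommGroup H] [InnerProductSpace ℝ H]
  {Ω : Type*} {m mΩ : MeasurableSpace Ω} {P : Measure Ω} {Z g h : Ω → H} {C : ℝ}

lemma integrable_inner_of_bound (hZ : AEStronglyMeasurable Z P) (hg : Integrable g P)
    (hC : ∀ᵐ ω ∂P, ‖Z ω‖ ≤ C) : Integrable (fun ω => inner ℝ (Z ω) (g ω)) P := by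
  refine (hg.norm.const_mul C).mono' (hZ.inner hg.aestronglyMeasurable) ?_
  filter_upwards [hC] with ω hω
  exact (norm_inner_le_norm _ _).trans (by gcongr)

lemma integral_inner_sub_condExp_eq_zero [CompleteSpace H] [IsFiniteMeasure P] (hm : m ≤ mΩ)
    (hZ : StronglyMeasurable[m] Z) (hg : Integrable g P) (hC : ∀ᵐ ω ∂P, ‖Z ω‖ ≤ C)
    (hh : P[g|m] =ᵐ[P] h) : ∫ ω, inner ℝ (Z ω) (g ω - h ω) ∂P = 0 := by
  have hZ' := (hZ.mono hm).aestronglyMeasurable (μ := P)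
  have hhi : Integrable h P := integrable_condExp.congr hh
  have h1 : P[fun ω => inner ℝ (Z ω) (g ω)|m] =ᵐ[P] fun ω => inner ℝ (Z ω) (P[g|m] ω) :=
    condExp_stronglyMeasurable_bilin_of_bound (innerSL ℝ) hm hZ hg C hC
  have h2 : ∫ ω, inner ℝ (Z ω) (g ω) ∂P = ∫ ω, inner ℝ (Z ω) (h ω) ∂P := by
    rw [← integral_condExp hm]
    refine integral_congr_ae ?_
    filter_upwards [h1, hh] with ω h3 h4
    rw [h3, h4]
  simp only [inner_sub_right]
  rw [integral_sub (integrable_inner_of_bound hZ' hg hC) (integrable_inner_of_bound hZ' hhi hC),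
    h2, sub_self]

end CondExp

theorem bach_prop_boundp
    {H : Type*} [NormedAddCommGroup H] [InnerProductSpace ℝ H] [CompleteSpace H]
    {Ω : Type*} {mΩ : MeasurableSpace Ω} {P : Measure Ω} [IsProbabilityMeasure P]
    (ℱ : Filtration ℕ mΩ)
    (f : H → ℝ) (F : ℕ → Ω → H → ℝ) (θstar θ0 : H) (R γ : ℝ)
    (θ : ℕ → Ω → H)
    (hR : 0 < R)
    (hγ : 0 < γ)
    -- (A1) convexity and differentiability of f
    (hf_conv : ConvexOn ℝ Set.univ f)
    (hf_diff : Differentiable ℝ f)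
    -- (A3) attained global minimum
    (hmin : ∀ θ' : H, f θstar ≤ f θ')
    -- (A4) Lipschitz-continuity of f and the fₙ
    (hf_grad_bound : ∀ θ' : H, ‖gradient f θ'‖ ≤ R)
    (hF_grad_bound : ∀ n : ℕ, ∀ᵐ ω ∂P, ∀ θ' : H, ‖gradient (F n ω) θ'‖ ≤ R)
    (hF_conv : ∀ n ω, ConvexOn ℝ Set.univ (F n ω))
    (hF_diff : ∀ n ω, Differentiable ℝ (F n ω))
    -- (A5) adapted measurability
    (hF_meas : ∀ n : ℕ, ∀ x : H, StronglyMeasurable[ℱ n] (fun ω => F n ω x))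
    (hθ_adapted : ∀ n : ℕ, StronglyMeasurable[ℱ n] (θ n))
    -- (A6) unbiased gradients
    (hunbiased : ∀ n : ℕ, 1 ≤ n →
      P[(fun ω => gradient (F n ω) (θ (n - 1) ω))|ℱ (n - 1)]
        =ᵐ[P] fun ω => gradient f (θ (n - 1) ω))
    -- (A7) stochastic gradient recursion
    (hθ0 : ∀ ω, θ 0 ω = θ0)
    (hrec : ∀ n : ℕ, 1 ≤ n → ∀ ω,
      θ n ω = θ (n - 1) ω - γ • gradient (F n ω) (θ (n - 1) ω))
    (n : ℕ) (hn : 1 ≤ n) (p : ℕ) (hp : 1 ≤ p)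
    :
    ∫ ω, (2 * γ * n * (f (((n : ℝ))⁻¹ • ∑ k ∈ Finset.range n, θ k ω) - f θstar)
        + ‖θ n ω - θstar‖ ^ 2) ^ p ∂P
      ≤ (3 * ‖θ0 - θstar‖ ^ 2 + 20 * n * p * γ ^ 2 * R ^ 2) ^ p := by
  have hp' : (1 : ℝ) ≤ p := by exact_mod_cast hp
  set r := γ * R with hr
  have hr0 : 0 < r := by positivity
  have hgrad : ∀ y, f y - f θstar ≤ inner ℝ (gradient f y) (y - θstar) := fun y =>
    hf_conv.inner_gradient_sub_le (hf_diff y) θstar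
  have hlip : ∀ y, f y - f θstar ≤ R * ‖y - θstar‖ := fun y =>
    (hgrad y).trans ((real_inner_le_norm _ _).trans (by gcongr; exact hf_grad_bound y))
  let A : ℕ → Ω → ℝ := fun n ω => energy f θstar γ (fun k => θ k ω) n
  let g : ℕ → Ω → H := fun n ω => gradient (F (n + 1) ω) (θ n ω)
  have hθ_succ : ∀ n ω, θ (n + 1) ω = θ n ω - γ • g n ω := fun n ω => hrec (n + 1) (by omega) ω
  have hA0 : ∀ n ω, 0 ≤ A n ω := fun n ω => energy_nonneg hγ.le hmin n
  have hgR : ∀ᵐ ω ∂P, ∀ n, ‖g n ω‖ ≤ R := by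
    filter_upwards [ae_all_iff.2 hF_grad_bound] with ω h n
    exact h _ _
  have hAB : ∀ᵐ ω ∂P, ∀ n : ℕ, A n ω ≤ 3 * ‖θ0 - θstar‖ ^ 2 + 4 * n ^ 2 * r ^ 2 := by
    filter_upwards [hgR] with ω h n
    rw [← hθ0 ω]
    refine energy_le (x := fun k => θ k ω) hγ.le hR.le hlip (fun k => ?_) n
    rw [hθ_succ, sub_sub_cancel_left, norm_neg, norm_smul, Real.norm_of_nonneg hγ.le]
    gcongr
    exact h k
  have hAmeas : ∀ n, StronglyMeasurable[ℱ n] (A n) := fun n => by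
    refine StronglyMeasurable.add (StronglyMeasurable.const_mul ?_ _)
      (((hθ_adapted n).sub stronglyMeasurable_const).norm.pow 2)
    refine Finset.stronglyMeasurable_fun_sum _ fun k hk => StronglyMeasurable.sub
      (hf_diff.continuous.comp_stronglyMeasurable
        ((hθ_adapted k).mono (ℱ.mono (Finset.mem_range.1 hk).le))) stronglyMeasurable_const
  have hAint : ∀ n, Integrable (fun ω => A n ω ^ p) P := fun n => by
    refine Integrable.of_bound (((hAmeas n).mono (ℱ.le n)).pow p).aestronglyMeasurable
      ((3 * ‖θ0 - θstar‖ ^ 2 + 4 * n ^ 2 * r ^ 2) ^ p) ?_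
    filter_upwards [hAB] with ω h
    rw [Real.norm_of_nonneg (pow_nonneg (hA0 n ω) p)]
    exact pow_le_pow_left₀ (hA0 n ω) (h n) p
  have hgint : ∀ n, Integrable (g n) P := fun n => by
    have e : g n = fun ω => γ⁻¹ • (θ n ω - θ (n + 1) ω) := by
      funext ω
      rw [hθ_succ, sub_sub_cancel, inv_smul_smul₀ hγ.ne']
    refine Integrable.of_bound ?_ R (hgR.mono fun ω h => h n)
    rw [e]
    exact ((((hθ_adapted n).mono (ℱ.le n)).sub
      ((hθ_adapted (n + 1)).mono (ℱ.le (n + 1)))).const_smul _).aestronglyMeasurable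
  have hcond : ∀ n, P[g n|ℱ n] =ᵐ[P] fun ω => gradient f (θ n ω) := fun n =>
    hunbiased (n + 1) (by omega)
  have hmain : ∀ n : ℕ, ∫ ω, A n ω ^ p ∂P ≤ (3 * ‖θ0 - θstar‖ ^ 2 + 20 * n * p * r ^ 2) ^ p := by
    intro n
    induction n with
    | zero =>
      have : ∀ ω, A 0 ω = ‖θ0 - θstar‖ ^ 2 := fun ω => by simp [A, energy, hθ0]
      simp only [this, integral_const, probReal_univ, one_smul]
      gcongr
      have : 0 ≤ ‖θ0 - θstar‖ ^ 2 := by positivity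
      simp
      linarith
    | succ n ih =>
      rcases le_or_gt (n + 1) (5 * p) with hnp | hnp
      · have hnp' : ((n + 1 : ℕ) : ℝ) ≤ 5 * p := by exact_mod_cast hnp
        calc ∫ ω, A (n + 1) ω ^ p ∂P
            ≤ ∫ _, (3 * ‖θ0 - θstar‖ ^ 2 + 20 * (n + 1 : ℕ) * p * r ^ 2) ^ p ∂P := by
              refine integral_mono_ae (hAint _) (integrable_const _) ?_
              filter_upwards [hAB] with ω h
              refine pow_le_pow_left₀ (hA0 _ ω) ((h (n + 1)).trans ?_) p
              have : (4 * ((n + 1 : ℕ) : ℝ) ^ 2) ≤ 20 * (n + 1 : ℕ) * p := by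
                nlinarith [Nat.cast_nonneg (α := ℝ) (n + 1)]
              gcongr
          _ = _ := by simp
      · have hnp' : (5 * p : ℝ) ≤ n := by exact_mod_cast Nat.lt_succ_iff.1 hnp
        set U := 3 * ‖θ0 - θstar‖ ^ 2 + 20 * n * p * r ^ 2 with hU
        have hUr : (10 * p * r) ^ 2 ≤ U := by
          have h1 : 0 ≤ ‖θ0 - θstar‖ ^ 2 := by positivity
          have h2 := mul_le_mul_of_nonneg_right hnp' (by positivity : 0 ≤ 20 * (p : ℝ) * r ^ 2)
          nlinarith
        have hU0 : 0 < U := lt_of_lt_of_le (by positivity) hUr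
        let M : Ω → ℝ := fun ω =>
          -2 * γ * inner ℝ (θ n ω - θstar) (g n ω - gradient f (θ n ω))
        let Z : Ω → H := fun ω => (A n ω + r ^ 2) ^ (p - 1) • (θ n ω - θstar)
        have hdA : ∀ ω, ‖θ n ω - θstar‖ ≤ √(A n ω) := fun ω =>
          Real.le_sqrt_of_sq_le (sq_norm_le_energy (x := fun k => θ k ω) hγ.le hmin n)
        have hZM : (fun ω => (A n ω + r ^ 2) ^ (p - 1) * M ω) = fun ω =>
            -2 * γ * inner ℝ (Z ω) (g n ω - gradient f (θ n ω)) := by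
          funext ω
          simp only [M, Z, real_inner_smul_left]
          ring
        have hZ : StronglyMeasurable[ℱ n] Z :=
          (((hAmeas n).add stronglyMeasurable_const).pow _).smul
            ((hθ_adapted n).sub stronglyMeasurable_const)
        set B := 3 * ‖θ0 - θstar‖ ^ 2 + 4 * n ^ 2 * r ^ 2
        have hZC : ∀ᵐ ω ∂P, ‖Z ω‖ ≤ (B + r ^ 2) ^ (p - 1) * √B := by
          filter_upwards [hAB] with ω h
          have h0 := hA0 n ω
          rw [norm_smul, Real.norm_of_nonneg (by positivity)]
          gcongr
          · exact h n
          · exact (hdA ω).trans (Real.sqrt_le_sqrt (h n))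
        have hstep := integral_pow_le_of_step (P := P) (A := A n) (A' := A (n + 1)) (M := M)
          (V := √U) (r := r) hp (Real.sqrt_pos.2 hU0) hr0.le (Real.le_sqrt_of_sq_le hUr)
          (hA0 n) (hA0 (n + 1)) ?_ ?_ (hAint n) ?_ ?_ ?_
        · rw [Real.sq_sqrt hU0.le] at hstep
          refine hstep.trans (le_of_eq ?_)
          rw [hU]
          push_cast
          ring
        · filter_upwards [hgR] with ω h
          exact energy_succ_le (x := fun k => θ k ω) hγ.le (hθ_succ n ω) (h n) (hgrad _) rfl
        · filter_upwards [hgR] with ω h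
          have h1 : ‖g n ω - gradient f (θ n ω)‖ ≤ 2 * R :=
            (norm_sub_le _ _).trans (by linarith [h n, hf_grad_bound (θ n ω)])
          have h2 := (abs_real_inner_le_norm (θ n ω - θstar) (g n ω - gradient f (θ n ω))).trans
            (mul_le_mul (hdA ω) h1 (norm_nonneg _) (Real.sqrt_nonneg _))
          simp only [M]
          rw [abs_mul, abs_of_nonpos (by linarith : -2 * γ ≤ 0)]
          have := mul_le_mul_of_nonneg_left h2 (by linarith : 0 ≤ -(-2 * γ))
          rw [hr]
          linarith
        · rw [hZM]
          exact (integrable_inner_of_bound (hZ.mono (ℱ.le n)).aestronglyMeasurable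
            ((hgint n).sub (integrable_condExp.congr (hcond n))) hZC).const_mul _
        · rw [hZM, integral_const_mul,
            integral_inner_sub_condExp_eq_zero (ℱ.le n) hZ (hgint n) hZC (hcond n), mul_zero]
        · rwa [Real.sq_sqrt hU0.le]
  calc _ ≤ ∫ ω, A n ω ^ p ∂P := by
        have h0 : ∀ ω, 0 ≤ 2 * γ * n * (f (((n : ℝ))⁻¹ • ∑ k ∈ Finset.range n, θ k ω) - f θstar)
            + ‖θ n ω - θstar‖ ^ 2 := fun ω => by
          have := sub_nonneg.2 (hmin (((n : ℝ))⁻¹ • ∑ k ∈ Finset.range n, θ k ω))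
          positivity
        exact integral_mono_of_nonneg (.of_forall fun ω => pow_nonneg (h0 ω) p) (hAint n)
          (.of_forall fun ω => pow_le_pow_left₀ (h0 ω)
            (average_le_energy (x := fun k => θ k ω) hγ.le hf_conv hn) p)
    _ ≤ _ := hmain n
    _ = _ := by rw [hr]; ring
end

section
/- Let φ : [0,1] → ℝ be a strictly convex three-times differentiable function such that for some S > 0 one has |φ'''(t)| ≤ S·φ''(t) for all t ∈ [0,1], and assume φ'(0) = 0 and φ''(0) > 0. Then: (i) φ'(1)·S/φ''(0) ≥ 1 − e^{−S}; (ii) φ(1) ≤ φ(0) + (φ'(1)²/φ''(0))·(1 + S); (iii) if α = φ'(1)·S/φ''(0) < 1, then φ(1) ≤ φ(0) + (φ'(1)²/φ''(0))·(1/α)·log(1/(1−α)); and (iv) if in addition α ≤ 3/4, then φ(1) ≤ φ(0) + 2φ'(1)²/φ''(0) and φ''(0) ≤ 2φ'(1). -/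
open MeasureTheory

theorem monotoneOn_Icc_of_hasDerivAt_nonneg {f f' : ℝ → ℝ} {a b : ℝ}
    (hf : ∀ t ∈ Set.Icc a b, HasDerivAt f (f' t) t) (hf' : ∀ t ∈ Set.Icc a b, 0 ≤ f' t) :
    MonotoneOn f (Set.Icc a b) := by
  refine monotoneOn_of_hasDerivWithinAt_nonneg (f' := f') (convex_Icc a b)
    (fun t ht => (hf t ht).continuousAt.continuousWithinAt)
    (fun t ht => (hf t (interior_subset ht)).hasDerivWithinAt)
    (fun t ht => hf' t (interior_subset ht))

theorem neg_log_one_sub_le_two_mul {x : ℝ} (h0 : 0 ≤ x) (h1 : x ≤ 3 / 4) :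
    -Real.log (1 - x) ≤ 2 * x := by
  have hlog4 : Real.log 4 ≤ 3 / 2 := by
    rw [show (4 : ℝ) = 2 ^ 2 by norm_num, Real.log_pow]
    have := Real.log_two_lt_d9
    norm_num at this ⊢
    linarith
  have hconc := strictConcaveOn_log_Ioi.concaveOn.2
    (show (1 : ℝ) ∈ Set.Ioi 0 by norm_num) (show (1 / 4 : ℝ) ∈ Set.Ioi 0 by norm_num)
    (show 0 ≤ 1 - 4 * x / 3 by linarith) (show 0 ≤ 4 * x / 3 by linarith) (by ring)
  rw [show (1 - 4 * x / 3) • (1 : ℝ) + (4 * x / 3) • (1 / 4 : ℝ) = 1 - x by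
    simp only [smul_eq_mul]; ring] at hconc
  simp only [smul_eq_mul, Real.log_one, one_div, Real.log_inv] at hconc
  nlinarith

theorem bach_lemma_selfc
    (φ : ℝ → ℝ) (S : ℝ) (hS : 0 < S)
    (hφ : ContDiff ℝ 3 φ)
    (hconv : ∀ t ∈ Set.Icc (0 : ℝ) 1, 0 < deriv (deriv φ) t)
    (hsc : ∀ t ∈ Set.Icc (0 : ℝ) 1, |deriv (deriv (deriv φ)) t| ≤ S * deriv (deriv φ) t)
    (h0 : deriv φ 0 = 0) :
    deriv φ 1 * S / deriv (deriv φ) 0 ≥ 1 - Real.exp (-S) ∧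
    φ 1 ≤ φ 0 + deriv φ 1 ^ 2 / deriv (deriv φ) 0 * (1 + S) ∧
    (deriv φ 1 * S / deriv (deriv φ) 0 < 1 →
      φ 1 ≤ φ 0 + deriv φ 1 ^ 2 / deriv (deriv φ) 0 *
        ((deriv φ 1 * S / deriv (deriv φ) 0)⁻¹ *
          Real.log (1 / (1 - deriv φ 1 * S / deriv (deriv φ) 0)))) ∧
    (deriv φ 1 * S / deriv (deriv φ) 0 ≤ 3 / 4 →
      φ 1 ≤ φ 0 + 2 * deriv φ 1 ^ 2 / deriv (deriv φ) 0 ∧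
      deriv (deriv φ) 0 ≤ 2 * deriv φ 1)
    := by
  have c2 : ContDiff ℝ 2 (deriv φ) :=
    (contDiff_succ_iff_deriv.1 (show ContDiff ℝ (2 + 1) φ by norm_num; exact hφ)).2.2
  have c1 : ContDiff ℝ 1 (deriv (deriv φ)) :=
    (contDiff_succ_iff_deriv.1 (show ContDiff ℝ (1 + 1) (deriv φ) by norm_num; exact c2)).2.2
  have d0 (t : ℝ) : HasDerivAt φ (deriv φ t) t :=
    (hφ.differentiable (by norm_num) t).hasDerivAt
  have d1 (t : ℝ) : HasDerivAt (deriv φ) (deriv (deriv φ) t) t :=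
    (c2.differentiable (by norm_num) t).hasDerivAt
  have d2 (t : ℝ) : HasDerivAt (deriv (deriv φ)) (deriv (deriv (deriv φ)) t) t :=
    (c1.differentiable (by norm_num) t).hasDerivAt
  generalize deriv (deriv (deriv φ)) = k at *
  generalize deriv (deriv φ) = h at *
  generalize deriv φ = g at *
  clear c1 c2 hφ
  have m0 : (0 : ℝ) ∈ Set.Icc (0 : ℝ) 1 := by norm_num
  have m1 : (1 : ℝ) ∈ Set.Icc (0 : ℝ) 1 := by norm_num
  have ha := hconv 0 m0
  have gmono : MonotoneOn g (Set.Icc 0 1) :=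
    monotoneOn_Icc_of_hasDerivAt_nonneg (fun t _ => d1 t) fun t ht => (hconv t ht).le
  have gnonneg : ∀ t ∈ Set.Icc (0 : ℝ) 1, 0 ≤ g t := fun t ht => by
    simpa [h0] using gmono m0 ht ht.1
  have gle : ∀ t ∈ Set.Icc (0 : ℝ) 1, g t ≤ g 1 := fun t ht => gmono ht m1 ht.2
  have key : ∀ t ∈ Set.Icc (0 : ℝ) 1, h 0 ≤ h t + S * g t := fun t ht => by
    have := monotoneOn_Icc_of_hasDerivAt_nonneg (a := 0) (b := 1)
      (fun t _ => (d2 t).add ((d1 t).const_mul S))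
      (fun t ht => by linarith [neg_abs_le (k t), hsc t ht]) m0 ht ht.1
    simpa [h0] using this
  have hexp : 1 - Real.exp (-S) ≤ g 1 * S / h 0 := by
    have := monotoneOn_Icc_of_hasDerivAt_nonneg (a := 0) (b := 1)
      (fun t _ => ((hasDerivAt_id t).const_mul S).exp.mul (((d1 t).const_mul S).sub_const (h 0)))
      (fun t ht => by
        have e := Real.exp_pos (S * t)
        have := mul_nonneg (mul_pos e hS).le (sub_nonneg.2 (key t ht))
        simp only [id]
        linarith) m0 m1 zero_le_one
    simp only [Pi.mul_apply, id, mul_zero, Real.exp_zero, h0, mul_one, one_mul, zero_sub] at this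
    have e : Real.exp (-S) * Real.exp S = 1 := by rw [← Real.exp_add]; simp
    have := mul_le_mul_of_nonneg_left this (Real.exp_pos (-S)).le
    rw [← mul_assoc, e] at this
    rw [le_div_iff₀ ha]
    linarith
  have hβ : 0 < 1 - Real.exp (-S) := by
    have := Real.exp_lt_one_iff.2 (neg_lt_zero.2 hS)
    linarith
  have hα := hβ.trans_le hexp
  have hlog : g 1 * S / h 0 < 1 → φ 1 ≤ φ 0 + g 1 ^ 2 / h 0 *
      ((g 1 * S / h 0)⁻¹ * Real.log (1 / (1 - g 1 * S / h 0))) := fun hlt => by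
    have hpos : ∀ t ∈ Set.Icc (0 : ℝ) 1, 0 < h 0 - S * g t := fun t ht => by
      have h1 := (div_lt_one ha).1 hlt
      nlinarith [gle t ht]
    have hF := monotoneOn_Icc_of_hasDerivAt_nonneg (a := 0) (b := 1)
      (fun t ht => ((((d1 t).const_mul (-1 / S))).sub
        (((((d1 t).const_mul S).const_sub (h 0)).log (hpos t ht).ne').const_mul
          (h 0 / S ^ 2))).sub (d0 t))
      (fun t ht => by
        have hp := hpos t ht
        have : -1 / S * h t - h 0 / S ^ 2 * (-(S * h t) / (h 0 - S * g t)) - g t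
            = g t * (h t + S * g t - h 0) / (h 0 - S * g t) := by
          field_simp
          ring
        rw [this]
        exact div_nonneg (mul_nonneg (gnonneg t ht) (sub_nonneg.2 (key t ht))) hp.le)
      m0 m1 zero_le_one
    simp only [Pi.sub_apply, h0, mul_zero, sub_zero, zero_sub] at hF
    generalize hαdef : g 1 * S / h 0 = α at *
    have hg : g 1 = α * h 0 / S := by rw [← hαdef]; field_simp
    have h1α : 0 < 1 - α := sub_pos.2 hlt
    have hl : Real.log (h 0 - S * g 1) = Real.log (h 0) + Real.log (1 - α) := by
      rw [← Real.log_mul ha.ne' h1α.ne', hg]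
      congr 1
      field_simp
    rw [hl] at hF
    have hL : -Real.log (1 - α) * (1 - α) ≤ α := by
      have := Real.log_le_sub_one_of_pos (inv_pos.2 h1α)
      rw [Real.log_inv] at this
      have := mul_le_mul_of_nonneg_right this h1α.le
      rw [sub_mul, inv_mul_cancel₀ h1α.ne'] at this
      linarith
    rw [one_div, Real.log_inv]
    have e1 : g 1 ^ 2 / h 0 * (α⁻¹ * -Real.log (1 - α))
        = h 0 / S ^ 2 * (α * -Real.log (1 - α)) := by
      rw [hg]; field_simp
    have e2 : -1 / S * g 1 = h 0 / S ^ 2 * -α := by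
      rw [hg]; field_simp
    rw [e1]
    rw [e2] at hF
    have := mul_le_mul_of_nonneg_left hL (div_pos ha (pow_pos hS 2)).le
    linarith
  refine ⟨hexp, ?_, hlog, fun hle => ⟨?_, ?_⟩⟩
  · have hF := monotoneOn_Icc_of_hasDerivAt_nonneg (a := 0) (b := 1)
      (fun t _ => ((((d1 t).pow 2).const_mul (1 / 2)).add
        ((hasDerivAt_id t).const_mul (S * g 1 ^ 2))).sub ((d0 t).const_mul (h 0)))
      (fun t ht => by
        have h1 := mul_nonneg (gnonneg t ht) (sub_nonneg.2 (key t ht))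
        have h2 := mul_le_mul_of_nonneg_left
          (pow_le_pow_left₀ (gnonneg t ht) (gle t ht) 2) hS.le
        norm_num
        linarith) m0 m1 zero_le_one
    simp [h0] at hF
    have : φ 1 - φ 0 ≤ g 1 ^ 2 * (1 + S) / h 0 := by
      rw [le_div_iff₀ ha]
      nlinarith [sq_nonneg (g 1)]
    rw [div_mul_eq_mul_div]
    linarith
  · have hl := neg_log_one_sub_le_two_mul hα.le hle
    refine (hlog (by linarith)).trans ?_
    rw [one_div, Real.log_inv, mul_comm 2 (g 1 ^ 2), mul_div_right_comm (g 1 ^ 2)]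
    gcongr
    rwa [inv_mul_le_iff₀ hα, mul_comm _ 2]
  · have hl := neg_log_one_sub_le_two_mul hβ.le (hexp.trans hle)
    rw [sub_sub_cancel, Real.log_exp, neg_neg] at hl
    have h2 : S ≤ 2 * (g 1 * S / h 0) := by linarith
    rw [← mul_div_assoc, le_div_iff₀ ha] at h2
    nlinarith
end

section
/- Under assumptions (A1) and (A3–A7), with constant step size γ > 0, the following almost sure bound holds for every n ≥ 1: 2γn·(f(θ̄_n) − f(θ*)) + ‖θ_n − θ*‖² ≤ 3‖θ_0 − θ*‖² + 5n²γ²R² almost surely, where θ̄_n = (1/n)·Σ_{k=0}^{n−1} θ_k. -/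
open MeasureTheory

lemma norm_fderiv_eq_norm_gradient {H : Type*} [NormedAddCommGroup H] [InnerProductSpace ℝ H]
    [CompleteSpace H] (f : H → ℝ) (x : H) : ‖fderiv ℝ f x‖ = ‖gradient f x‖ := by
  simp [gradient]

/-- A differentiable function whose gradient is bounded by `R` is `R`-Lipschitz. -/
lemma sub_le_of_norm_gradient_le {H : Type*} [NormedAddCommGroup H] [InnerProductSpace ℝ H]
    [CompleteSpace H] {f : H → ℝ} {R : ℝ} (hf : Differentiable ℝ f)
    (hR : ∀ x, ‖gradient f x‖ ≤ R) (x y : H) : f x - f y ≤ R * ‖x - y‖ :=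
  (le_abs_self _).trans <| convex_univ.norm_image_sub_le_of_norm_fderiv_le
    (fun z _ => hf z) (fun z _ => (norm_fderiv_eq_norm_gradient f z).trans_le (hR z))
    (Set.mem_univ y) (Set.mem_univ x)

/-- A sequence with steps of length at most `r` is within `d + k * r` of any point at distance `d`
from its start. -/
lemma norm_sub_le_add_mul_of_step_le {H : Type*} [SeminormedAddCommGroup H] {u : ℕ → H} {r : ℝ}
    (hu : ∀ k, ‖u (k + 1) - u k‖ ≤ r) (c : H) (k : ℕ) :
    ‖u k - c‖ ≤ ‖u 0 - c‖ + k * r := by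
  induction k with
  | zero => simp
  | succ k ih =>
    have h := norm_sub_le_norm_sub_add_norm_sub (u (k + 1)) (u k) c
    push_cast
    linarith [hu k]

lemma norm_average_sub_le {H : Type*} [SeminormedAddCommGroup H] [NormedSpace ℝ H] {u : ℕ → H}
    {n : ℕ} (hn : n ≠ 0) {c : H} {B : ℝ} (hu : ∀ k < n, ‖u k - c‖ ≤ B) :
    ‖(n : ℝ)⁻¹ • ∑ k ∈ Finset.range n, u k - c‖ ≤ B := by
  have hn' : (0 : ℝ) < n := by positivity
  have hsum : (n : ℝ)⁻¹ • ∑ k ∈ Finset.range n, u k - c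
      = (n : ℝ)⁻¹ • ∑ k ∈ Finset.range n, (u k - c) := by
    rw [Finset.sum_sub_distrib, smul_sub, Finset.sum_const, Finset.card_range,
      ← Nat.cast_smul_eq_nsmul ℝ, inv_smul_smul₀ hn'.ne']
  rw [hsum, norm_smul, norm_inv, Real.norm_of_nonneg hn'.le, inv_mul_le_iff₀ hn']
  refine (norm_sum_le_of_le _ fun k hk => hu k (Finset.mem_range.mp hk)).trans_eq ?_
  simp

theorem bach_almost_sure_bound
    {H : Type*} [NormedAddCommGroup H] [InnerProductSpace ℝ H] [CompleteSpace H]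
    {Ω : Type*} {mΩ : MeasurableSpace Ω} {P : Measure Ω} [IsProbabilityMeasure P]
    (ℱ : Filtration ℕ mΩ)
    (f : H → ℝ) (F : ℕ → Ω → H → ℝ) (θstar θ0 : H) (R γ : ℝ)
    (θ : ℕ → Ω → H)
    (hR : 0 < R)
    (hγ : 0 < γ)
    -- (A1) convexity and differentiability of f
    (hf_conv : ConvexOn ℝ Set.univ f)
    (hf_diff : Differentiable ℝ f)
    -- (A3) attained global minimum
    (hmin : ∀ θ' : H, f θstar ≤ f θ')
    -- (A4) Lipschitz-continuity of f and the fₙ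
    (hf_grad_bound : ∀ θ' : H, ‖gradient f θ'‖ ≤ R)
    (hF_grad_bound : ∀ n : ℕ, ∀ᵐ ω ∂P, ∀ θ' : H, ‖gradient (F n ω) θ'‖ ≤ R)
    (hF_conv : ∀ n ω, ConvexOn ℝ Set.univ (F n ω))
    (hF_diff : ∀ n ω, Differentiable ℝ (F n ω))
    -- (A5) adapted measurability
    (hF_meas : ∀ n : ℕ, ∀ x : H, StronglyMeasurable[ℱ n] (fun ω => F n ω x))
    (hθ_adapted : ∀ n : ℕ, StronglyMeasurable[ℱ n] (θ n))
    -- (A6) unbiased gradients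
    (hunbiased : ∀ n : ℕ, 1 ≤ n →
      P[(fun ω => gradient (F n ω) (θ (n - 1) ω))|ℱ (n - 1)]
        =ᵐ[P] fun ω => gradient f (θ (n - 1) ω))
    -- (A7) stochastic gradient recursion
    (hθ0 : ∀ ω, θ 0 ω = θ0)
    (hrec : ∀ n : ℕ, 1 ≤ n → ∀ ω,
      θ n ω = θ (n - 1) ω - γ • gradient (F n ω) (θ (n - 1) ω))
    (n : ℕ) (hn : 1 ≤ n)
    :
    ∀ᵐ ω ∂P,
      2 * γ * n * (f (((n : ℝ))⁻¹ • ∑ k ∈ Finset.range n, θ k ω) - f θstar) + ‖θ n ω - θstar‖ ^ 2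
        ≤ 3 * ‖θ0 - θstar‖ ^ 2 + 5 * n ^ 2 * γ ^ 2 * R ^ 2 := by
  filter_upwards [ae_all_iff.mpr hF_grad_bound] with ω hω
  have hstep (k : ℕ) : ‖θ (k + 1) ω - θ k ω‖ ≤ γ * R := by
    rw [hrec (k + 1) k.succ_pos ω, Nat.add_sub_cancel, sub_sub_cancel_left, norm_neg, norm_smul,
      Real.norm_of_nonneg hγ.le]
    exact mul_le_mul_of_nonneg_left (hω _ _) hγ.le
  have hdist (k : ℕ) : ‖θ k ω - θstar‖ ≤ ‖θ0 - θstar‖ + k * (γ * R) := by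
    simpa [hθ0] using norm_sub_le_add_mul_of_step_le (u := fun k => θ k ω) hstep θstar k
  have havg : ‖(n : ℝ)⁻¹ • ∑ k ∈ Finset.range n, θ k ω - θstar‖
      ≤ ‖θ0 - θstar‖ + n * (γ * R) := by
    refine norm_average_sub_le (by lia) fun k hk => (hdist k).trans ?_
    gcongr
  have hvalue : f ((n : ℝ)⁻¹ • ∑ k ∈ Finset.range n, θ k ω) - f θstar
      ≤ R * (‖θ0 - θstar‖ + n * (γ * R)) :=
    (sub_le_of_norm_gradient_le hf_diff hf_grad_bound _ _).trans (by gcongr)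
  calc
    _ ≤ 2 * γ * n * (R * (‖θ0 - θstar‖ + n * (γ * R)))
        + (‖θ0 - θstar‖ + n * (γ * R)) ^ 2 := by
      gcongr
      exact hdist n
    _ ≤ _ := by nlinarith [sq_nonneg (‖θ0 - θstar‖ - n * (γ * R))]
end
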